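/- Let t ≥ 1, let g₁,…,g_t be real numbers, and let a be a real number with 0 < a < √2. Then the ratio R = (1 − (1/t)·∑_{i=1}^t cos(g_i·a)) / (1 − exp(−a²/2)) satisfies the two-sided bound ((1/t)·∑_{i=1}^t g_i²) − (a²/12)·((1/t)·∑_{i=1}^t g_i⁴) ≤ R ≤ (1/(1 − a²/2))·((1/t)·∑_{i=1}^t g_i²). -/

import Mathlib

theorem cos_quartic_aux {x : ℝ} (hx : 0 ≤ x) :
    Real.cos x ≤ 1 - x ^ 2 / 2 + x ^ 4 / 24 := by
  have hd : ∀ y : ℝ, HasDerivAt (fun y : ℝ => 1 - y ^ 2 / 2 + y ^ 4 / 24 - Real.cos y)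
      (-y + y ^ 3 / 6 + Real.sin y) y := by
    intro y
    have h := (((hasDerivAt_const y (1 : ℝ)).sub ((hasDerivAt_pow 2 y).div_const 2)).add
      ((hasDerivAt_pow 4 y).div_const 24)).sub (Real.hasDerivAt_cos y)
    refine h.congr_deriv ?_
    push_cast
    norm_num
    ring
  have hm : MonotoneOn (fun y : ℝ => 1 - y ^ 2 / 2 + y ^ 4 / 24 - Real.cos y) (Set.Ici 0) := by
    apply monotoneOn_of_deriv_nonneg (convex_Ici 0)
    · exact fun y _ => (hd y).continuousAt.continuousWithinAt
    · exact fun y _ => (hd y).differentiableAt.differentiableWithinAt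
    · intro y hy
      rw [interior_Ici] at hy
      rw [(hd y).deriv]
      have := Real.sin_gt_sub_cube (Set.mem_Ioi.1 hy)
      linarith
  have h := hm (Set.mem_Ici.2 le_rfl) (Set.mem_Ici.2 hx) hx
  simp at h
  linarith

theorem cos_quartic (x : ℝ) : Real.cos x ≤ 1 - x ^ 2 / 2 + x ^ 4 / 24 := by
  rcases le_total 0 x with h | h
  · exact cos_quartic_aux h
  · have := cos_quartic_aux (neg_nonneg.2 h)
    rw [Real.cos_neg] at this
    convert this using 1
    ring

theorem taylor_sandwich_ratio (t : ℕ) (ht : 1 ≤ t) (g : Fin t → ℝ) (a : ℝ)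
    (ha : 0 < a) (ha2 : a < Real.sqrt 2) :
    ((1 / (t : ℝ)) * ∑ i, (g i) ^ 2) -
        (a ^ 2 / 12) * ((1 / (t : ℝ)) * ∑ i, (g i) ^ 4) ≤
      (1 - (1 / (t : ℝ)) * ∑ i, Real.cos (g i * a)) /
        (1 - Real.exp (-a ^ 2 / 2)) ∧
    (1 - (1 / (t : ℝ)) * ∑ i, Real.cos (g i * a)) /
        (1 - Real.exp (-a ^ 2 / 2)) ≤
      (1 / (1 - a ^ 2 / 2)) * ((1 / (t : ℝ)) * ∑ i, (g i) ^ 2) := by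
  have htpos : (0 : ℝ) < t := by exact_mod_cast ht
  have hasq : a ^ 2 < 2 := (Real.lt_sqrt ha.le).1 ha2
  have hap : 0 < a ^ 2 := by positivity
  have hN : 1 - (1 / (t : ℝ)) * ∑ i, Real.cos (g i * a)
      = (1 / (t : ℝ)) * ∑ i, (1 - Real.cos (g i * a)) := by
    rw [Finset.sum_sub_distrib]
    simp only [Finset.sum_const, Finset.card_univ, Fintype.card_fin, nsmul_eq_mul, mul_one]
    rw [mul_sub, one_div, inv_mul_cancel₀ htpos.ne']
  have hN0 : 0 ≤ 1 - (1 / (t : ℝ)) * ∑ i, Real.cos (g i * a) := by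
    rw [hN]
    exact mul_nonneg (by positivity)
      (Finset.sum_nonneg fun i _ => sub_nonneg.2 (Real.cos_le_one _))
  have hNu : 1 - (1 / (t : ℝ)) * ∑ i, Real.cos (g i * a)
      ≤ (a ^ 2 / 2) * ((1 / (t : ℝ)) * ∑ i, (g i) ^ 2) := by
    rw [hN, mul_left_comm, Finset.mul_sum _ _ (a ^ 2 / 2)]
    refine mul_le_mul_of_nonneg_left (Finset.sum_le_sum fun i _ => ?_) (by positivity)
    have := Real.one_sub_sq_div_two_le_cos (x := g i * a)
    nlinarith
  have hNl : (a ^ 2 / 2) * (((1 / (t : ℝ)) * ∑ i, (g i) ^ 2) -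
        (a ^ 2 / 12) * ((1 / (t : ℝ)) * ∑ i, (g i) ^ 4))
      ≤ 1 - (1 / (t : ℝ)) * ∑ i, Real.cos (g i * a) := by
    have e : (a ^ 2 / 2) * (((1 / (t : ℝ)) * ∑ i, (g i) ^ 2) -
        (a ^ 2 / 12) * ((1 / (t : ℝ)) * ∑ i, (g i) ^ 4))
        = (1 / (t : ℝ)) * ∑ i, ((a ^ 2 / 2) * (g i) ^ 2 - (a ^ 4 / 24) * (g i) ^ 4) := by
      rw [Finset.sum_sub_distrib, ← Finset.mul_sum, ← Finset.mul_sum]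
      ring
    rw [hN, e]
    refine mul_le_mul_of_nonneg_left (Finset.sum_le_sum fun i _ => ?_) (by positivity)
    have := cos_quartic (g i * a)
    rw [mul_pow, mul_pow] at this
    linarith
  have hS : 0 ≤ (1 / (t : ℝ)) * ∑ i, (g i) ^ 2 :=
    mul_nonneg (by positivity) (Finset.sum_nonneg fun i _ => sq_nonneg _)
  have hDu : 1 - Real.exp (-a ^ 2 / 2) ≤ a ^ 2 / 2 := by
    have := Real.add_one_le_exp (-a ^ 2 / 2)
    linarith
  have hDp : 0 < 1 - Real.exp (-a ^ 2 / 2) := by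
    have : Real.exp (-a ^ 2 / 2) < 1 := by
      rw [← Real.exp_zero]
      exact Real.exp_lt_exp.2 (by linarith)
    linarith
  have hDl : (a ^ 2 / 2) * (1 - a ^ 2 / 2) ≤ 1 - Real.exp (-a ^ 2 / 2) := by
    have h1 := Real.add_one_le_exp (a ^ 2 / 2)
    have h2 : Real.exp (-a ^ 2 / 2) * Real.exp (a ^ 2 / 2) = 1 := by
      rw [← Real.exp_add, ← Real.exp_zero]
      congr 1
      ring
    have h3 := Real.exp_pos (-a ^ 2 / 2)
    generalize Real.exp (-a ^ 2 / 2) = E at *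
    have h4 : E * (a ^ 2 / 2 + 1) ≤ 1 := by
      exact (mul_le_mul_of_nonneg_left h1 h3.le).trans h2.le
    generalize a ^ 2 / 2 = u at *
    have hu : 0 < u := by linarith
    have h5 : 0 ≤ u ^ 3 := by positivity
    have h6 : E * (u + 1) ≤ (1 - u * (1 - u)) * (u + 1) := by nlinarith
    have := le_of_mul_le_mul_right h6 (by linarith)
    linarith
  generalize 1 - (1 / (t : ℝ)) * ∑ i, Real.cos (g i * a) = N at *
  generalize (1 / (t : ℝ)) * ∑ i, (g i) ^ 2 = S at *
  generalize 1 - Real.exp (-a ^ 2 / 2) = D at *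
  constructor
  · rw [le_div_iff₀ hDp]
    generalize S - (a ^ 2 / 12) * ((1 / (t : ℝ)) * ∑ i, (g i) ^ 4) = L at *
    rcases le_total 0 L with h | h
    · nlinarith [mul_le_mul_of_nonneg_left hDu h]
    · exact (mul_nonpos_of_nonpos_of_nonneg h hDp.le).trans hN0
  · have hp : 0 < 1 - a ^ 2 / 2 := by linarith
    rw [div_le_iff₀ hDp, one_div, mul_assoc, ← div_eq_inv_mul, le_div_iff₀ hp]
    calc N * (1 - a ^ 2 / 2) ≤ (a ^ 2 / 2 * S) * (1 - a ^ 2 / 2) :=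
          mul_le_mul_of_nonneg_right hNu hp.le
      _ = S * ((a ^ 2 / 2) * (1 - a ^ 2 / 2)) := by ring
      _ ≤ S * D := mul_le_mul_of_nonneg_left hDl hS
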